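/- arXiv:1308.6044 — 2 statements merged into one kernel-verified Lean document; each statement's English description precedes it below -/
import Mathlib

section
/- Let (R, m) be a commutative Noetherian local ring. Then R is Gorenstein if and only if every parameter ideal of R is irreducible. -/
open IsLocalRing

/-- A parameter ideal of a Noetherian local ring: an ideal generated by a system of
parameters, i.e. by `d` elements of the maximal ideal (where `d` is the Krull dimension
of the ring) generating an ideal whose radical is the maximal ideal. -/
def IsParameterIdeal (R : Type*) [CommRing R] [IsLocalRing R] (I : Ideal R) : Prop :=
  ∃ (d : ℕ) (a : Fin d → R), ringKrullDim R = d ∧ (∀ i, a i ∈ maximalIdeal R) ∧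
    I = Ideal.span (Set.range a) ∧ I.radical = maximalIdeal R

/-- A ring is Gorenstein if it has finite injective dimension as a module over itself,
i.e. it admits an injective resolution vanishing in all sufficiently large degrees. -/
def HasFiniteInjectiveDimension (R : Type*) [CommRing R] : Prop :=
  ∃ (n : ℕ) (J : CategoryTheory.InjectiveResolution (ModuleCat.of R R)),
    ∀ i, n < i → CategoryTheory.Limits.IsZero (J.cocomplex.X i)

/-- An ideal is irreducible if it is proper and whenever it is the intersection of two
ideals it equals one of them. -/
def IsIrreducibleIdeal {R : Type*} [CommRing R] (I : Ideal R) : Prop :=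
  I ≠ ⊤ ∧ ∀ J K : Ideal R, I = J ⊓ K → I = J ∨ I = K

section

open CategoryTheory Limits Abelian

universe u v w

namespace CategoryTheory.InjectiveResolution

variable {C : Type u} [Category.{v} C] [Abelian C]

/-- The augmentation `X ⟶ J⁰` of an injective resolution `J` of `X`. -/
noncomputable def augmentation {X : C} (J : InjectiveResolution X) : X ⟶ J.cocomplex.X 0 :=
  J.ι.f 0

lemma augmentation_comp_d {X : C} (J : InjectiveResolution X) :
    J.augmentation ≫ J.cocomplex.d 0 1 = 0 :=
  J.ι_f_zero_comp_complex_d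

instance {X : C} (J : InjectiveResolution X) : Mono J.augmentation :=
  inferInstanceAs (Mono (J.ι.f 0))

lemma comp_augmentation_comp_d {X Y : C} (J : InjectiveResolution X) (g : Y ⟶ X) :
    (g ≫ J.augmentation) ≫ J.cocomplex.d 0 1 = 0 := by
  rw [Category.assoc, augmentation_comp_d, comp_zero]

/-- Splicing an injective resolution of the cokernel of a monomorphism into an injective object. -/
noncomputable def splice {S : ShortComplex C} (hS : S.ShortExact) [Injective S.X₂]
    (J : InjectiveResolution S.X₃) : InjectiveResolution S.X₁ where
  cocomplex := J.cocomplex.augment (S.g ≫ J.augmentation) (J.comp_augmentation_comp_d S.g)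
  injective n := by
    cases n with
    | zero => exact ‹Injective S.X₂›
    | succ n => exact J.injective n
  ι := (CochainComplex.fromSingle₀Equiv _ _).symm ⟨S.f,
    (S.zero_assoc _).trans zero_comp⟩
  quasiIso := ⟨fun n => by
    have hf := hS.mono_f
    have hg := hS.epi_g
    rcases n with _ | n
    · rw [CochainComplex.quasiIsoAt₀_iff, ShortComplex.quasiIso_iff_of_zeros]
      · refine (ShortComplex.exact_and_mono_f_iff_of_iso
          (S₁ := ShortComplex.mk S.f (S.g ≫ J.augmentation) (by simp)) ?_).1 ⟨?_, hf⟩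
        · exact ShortComplex.isoMk (Iso.refl _) (Iso.refl _) (Iso.refl _)
            ((Category.id_comp _).trans
              ((CochainComplex.fromSingle₀Equiv_symm_apply_f_zero
                (C := J.cocomplex.augment _ (J.comp_augmentation_comp_d S.g)) S.f
                ((S.zero_assoc _).trans zero_comp)).trans (Category.comp_id _).symm))
            ((Category.id_comp _).trans (Category.comp_id _).symm)
        · let α : S ⟶ ShortComplex.mk S.f (S.g ≫ J.augmentation) (by simp) :=
            { τ₁ := 𝟙 _
              τ₂ := 𝟙 _
              τ₃ := J.augmentation }
          exact (ShortComplex.exact_iff_of_epi_of_isIso_of_mono α).1 hS.exact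
      all_goals rfl
    · rw [quasiIsoAt_iff_exactAt]
      · rw [HomologicalComplex.exactAt_iff' _ n (n + 1) (n + 1 + 1) (by simp) (by simp)]
        rcases n with _ | n
        · let α : ShortComplex.mk (S.g ≫ J.augmentation) (J.cocomplex.d 0 1)
              (J.comp_augmentation_comp_d S.g) ⟶
              ShortComplex.mk (J.augmentation) (J.cocomplex.d 0 1) J.augmentation_comp_d :=
            { τ₁ := S.g
              τ₂ := 𝟙 _
              τ₃ := 𝟙 _ }
          have : Epi α.τ₁ := hg
          exact (ShortComplex.exact_iff_of_epi_of_isIso_of_mono α).2 J.exact₀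
        · exact J.exact_succ n
      · apply CochainComplex.exactAt_succ_single_obj⟩

/-- An object of injective dimension at most `n` has an injective resolution of length `n`. -/
lemma exists_isZero_of_hasInjectiveDimensionLT [EnoughInjectives C] (n : ℕ) (X : C)
    (h : HasInjectiveDimensionLT X (n + 1)) :
    ∃ J : InjectiveResolution X, ∀ i, n < i → IsZero (J.cocomplex.X i) := by
  induction n generalizing X with
  | zero =>
    have : Injective X := injective_iff_hasInjectiveDimensionLT_one.2 h
    refine ⟨self X, fun i hi => ?_⟩
    obtain ⟨j, rfl⟩ := Nat.exists_eq_succ_of_ne_zero hi.ne'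
    exact HomologicalComplex.isZero_single_obj_X _ _ _ _ (by simp)
  | succ n ih =>
    let ⟨ip⟩ := EnoughInjectives.presentation X
    have hS := ip.shortExact_shortComplex
    have : Injective ip.shortComplex.X₂ := ip.injective
    obtain ⟨J, hJ⟩ := ih _ ((hS.hasInjectiveDimensionLT_X₃_iff n this).2 h)
    refine ⟨splice hS J, fun i hi => ?_⟩
    obtain ⟨j, rfl⟩ := Nat.exists_eq_succ_of_ne_zero (n := i) (by lia)
    exact hJ j (by lia)

lemma hasInjectiveDimensionLT_of_isZero {X : C} (J : InjectiveResolution X) (n : ℕ)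
    (hJ : ∀ i, n ≤ i → IsZero (J.cocomplex.X i)) : HasInjectiveDimensionLT X n := by
  let := HasExt.standard C
  rw [hasInjectiveDimensionLT_iff]
  intro i hi Y e
  obtain ⟨f, hf, rfl⟩ := J.extMk_surjective e (i + 1) rfl
  obtain rfl : f = 0 := (hJ i hi).eq_of_tgt _ _
  simp

end CategoryTheory.InjectiveResolution

namespace ModuleCat

variable {R : Type u} [CommRing R]

lemma shortExact_of_exact {N₁ N₂ N₃ : Type u} [AddCommGroup N₁] [Module R N₁] [AddCommGroup N₂]
    [Module R N₂] [AddCommGroup N₃] [Module R N₃] (f : N₁ →ₗ[R] N₂) (g : N₂ →ₗ[R] N₃)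
    (hf : Function.Injective f) (hg : Function.Surjective g) (hfg : Function.Exact f g) :
    (shortComplexOfCompEqZero f g hfg.linearMap_comp_eq_zero).ShortExact :=
  shortComplex_shortExact _ hfg hf hg

/-- `Ext¹(R ⧸ I, M) = 0` for all ideals `I` implies that `M` is injective, and the analogous
criterion for higher injective dimensions. -/
lemma hasInjectiveDimensionLT_of_ext_quotient (n : ℕ) (M : ModuleCat.{u} R)
    (h : ∀ (I : Ideal R) (e : Ext (of R (R ⧸ I)) M (n + 1)), e = 0) :
    HasInjectiveDimensionLT M (n + 1) := by
  induction n generalizing M with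
  | zero =>
    rw [zero_add, ← injective_iff_hasInjectiveDimensionLT_one,
      ← Module.injective_iff_injective_object, ← Module.Baer.iff_injective]
    intro I g
    have hS := shortExact_of_exact I.subtype I.mkQ I.injective_subtype I.mkQ_surjective
      (LinearMap.exact_subtype_mkQ I)
    obtain ⟨x, hx⟩ := Ext.contravariant_sequence_exact₁ hS _ (Ext.mk₀ (ofHom g))
      (n₁ := 1) rfl (h I _)
    obtain ⟨f, rfl⟩ := (Ext.mk₀_bijective _ _).2 x
    rw [Ext.mk₀_comp_mk₀] at hx
    have hx' := (Ext.mk₀_bijective _ _).1 hx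
    refine ⟨f.hom, fun x hx => ?_⟩
    exact LinearMap.congr_fun (ModuleCat.hom_ext_iff.1 hx') ⟨x, hx⟩
  | succ n ih =>
    let ⟨ip⟩ := EnoughInjectives.presentation M
    have hS := ip.shortExact_shortComplex
    have : Injective ip.shortComplex.X₂ := ip.injective
    refine (hS.hasInjectiveDimensionLT_X₃_iff n this).1 (ih _ fun I e => ?_)
    obtain ⟨x, rfl⟩ := Ext.covariant_sequence_exact₃ _ hS e rfl (h I _)
    rw [Ext.eq_zero_of_injective x, Ext.zero_comp]

lemma ext_eq_zero_of_forall_prime [IsNoetherianRing R] (n : ℕ) (M : ModuleCat.{u} R)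
    (h : ∀ (p : Ideal R) [p.IsPrime] (e : Ext (of R (R ⧸ p)) M n), e = 0)
    (N : Type u) [AddCommGroup N] [Module R N] [Module.Finite R N] (e : Ext (of R N) M n) :
    e = 0 := by
  revert e
  induction ‹Module.Finite R N› using
    IsNoetherianRing.induction_on_isQuotientEquivQuotientPrime R with
  | subsingleton N =>
    intro e
    have : IsZero (of R N) := ModuleCat.isZero_of_subsingleton _
    rw [← Ext.mk₀_id_comp e, this.eq_of_src (𝟙 _) 0, Ext.mk₀_zero, Ext.zero_comp]
  | quotient N p f =>
    intro e
    have := h p.1 ((Ext.mk₀ f.toModuleIso.inv).comp e (zero_add n))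
    rw [← Ext.mk₀_id_comp e, ← f.toModuleIso.hom_inv_id, ← Ext.mk₀_comp_mk₀_assoc, this,
      Ext.comp_zero]
  | exact N₁ N₂ N₃ f g hf hg hfg h₁ h₃ =>
    intro e
    obtain ⟨x, rfl⟩ := Ext.contravariant_sequence_exact₂ (shortExact_of_exact f g hf hg hfg) _ e
      (h₁ _)
    rw [h₃ x, Ext.comp_zero]

variable [IsNoetherianRing R] [IsLocalRing R]

lemma ext_eq_zero_of_smul_surjective (N M : ModuleCat.{u} R) [Module.Finite R N]
    [Module.Finite R M] (n : ℕ) {x : R} (hx : x ∈ maximalIdeal R)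
    (h : ∀ e : Ext N M n, ∃ e' : Ext N M n, x • e' = e) (e : Ext N M n) : e = 0 := by
  have : (⊤ : Submodule R (Ext N M n)) = ⊥ := by
    refine Submodule.eq_bot_of_le_smul_of_le_jacobson_bot (maximalIdeal R) ⊤ Module.Finite.fg_top
      (fun e _ => ?_) (maximalIdeal_le_jacobson _)
    obtain ⟨e', rfl⟩ := h e
    exact Submodule.smul_mem_smul hx trivial
  exact (Submodule.mem_bot R).1 (this ▸ Submodule.mem_top)

lemma ext_eq_zero_of_isSMulRegular (N M : ModuleCat.{u} R) [Module.Finite R N]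
    [Module.Finite R M] (n : ℕ) {x : R} (hx : x ∈ maximalIdeal R) (hN : IsSMulRegular N x)
    (h : ∀ e : Ext (of R (QuotSMulTop x N)) M (n + 1), e = 0) (e : Ext N M n) : e = 0 := by
  refine ext_eq_zero_of_smul_surjective N M n hx (fun e => ?_) e
  obtain ⟨e', he'⟩ : ∃ e' : Ext N M n, (Ext.mk₀ (x • 𝟙 N)).comp e' (zero_add n) = e :=
    Ext.contravariant_sequence_exact₁ hN.smulShortComplex_shortExact _ e (add_comm 1 n) (h _)
  exact ⟨e', by simpa [Ext.mk₀_smul] using he'⟩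

lemma ext_quotient_prime_eq_zero (M : ModuleCat.{u} R) [Module.Finite R M] (n : ℕ)
    (h : HasInjectiveDimensionLT M (n + 1)) (p : Ideal R) [p.IsPrime] (hp : p ≠ maximalIdeal R)
    (e : Ext (of R (R ⧸ p)) M n) : e = 0 := by
  obtain ⟨x, hx, hxp⟩ := SetLike.exists_of_lt
    (lt_of_le_of_ne (le_maximalIdeal (Ideal.IsPrime.ne_top ‹_›)) hp)
  refine ext_eq_zero_of_isSMulRegular _ M n hx ?_ (fun e =>
    Ext.eq_zero_of_hasInjectiveDimensionLT e _ le_rfl) e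
  refine (isSMulRegular_iff_right_eq_zero_of_smul).2 fun y hy => ?_
  obtain ⟨y, rfl⟩ := Ideal.Quotient.mk_surjective y
  have hy : Ideal.Quotient.mk p (x * y) = 0 := hy
  rw [Ideal.Quotient.eq_zero_iff_mem] at hy ⊢
  exact (Ideal.IsPrime.mem_or_mem ‹_› hy).resolve_left hxp

end ModuleCat

namespace ModuleCat

variable {R : Type u} [CommRing R] [IsNoetherianRing R] [IsLocalRing R]

lemma hasInjectiveDimensionLT_self_of_socle {w : R} (hw0 : w ≠ 0)
    (hw : ∀ r ∈ maximalIdeal R, r * w = 0) (n : ℕ)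
    (h : HasInjectiveDimensionLT (of R R) (n + 2)) : HasInjectiveDimensionLT (of R R) (n + 1) := by
  refine hasInjectiveDimensionLT_of_ext_quotient n _ fun I => ext_eq_zero_of_forall_prime (n + 1) _
    (fun p hp e => ?_) (R ⧸ I)
  by_cases hpm : p = maximalIdeal R
  · subst hpm
    let f : (R ⧸ maximalIdeal R) →ₗ[R] R :=
      Submodule.liftQ _ (LinearMap.toSpanSingleton R R w) fun r hr => by simpa using hw r hr
    have hf : Function.Injective f := by
      rw [injective_iff_map_eq_zero]
      intro y hy
      obtain ⟨r, rfl⟩ := Ideal.Quotient.mk_surjective y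
      have hy : r * w = 0 := hy
      rw [Ideal.Quotient.eq_zero_iff_mem]
      by_contra hr
      exact hw0 ((IsLocalRing.notMem_maximalIdeal.1 hr).mul_right_eq_zero.1 hy)
    have hS := shortExact_of_exact f (LinearMap.range f).mkQ hf (Submodule.mkQ_surjective _)
      (LinearMap.exact_map_mkQ_range f)
    obtain ⟨x, rfl⟩ := Ext.contravariant_sequence_exact₁ hS _ e (add_comm 1 (n + 1))
      (Ext.eq_zero_of_hasInjectiveDimensionLT _ _ le_rfl)
    have : Projective (of R R) := inferInstance
    rw [show x = 0 from Ext.eq_zero_of_projective (P := of R R) x, Ext.comp_zero]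
  · exact ext_quotient_prime_eq_zero _ _ h p hpm e

lemma injective_self_of_socle {w : R} (hw0 : w ≠ 0)
    (hw : ∀ r ∈ maximalIdeal R, r * w = 0) (n : ℕ)
    (h : HasInjectiveDimensionLT (of R R) n) : Injective (of R R) := by
  rw [injective_iff_hasInjectiveDimensionLT_one]
  induction n with
  | zero => exact hasInjectiveDimensionLT_of_ge _ 0 1 zero_le_one
  | succ n ih =>
    cases n with
    | zero => exact h
    | succ n => exact ih (hasInjectiveDimensionLT_self_of_socle hw0 hw n h)

lemma eq_maximalIdeal_of_injective_self [Injective (of R R)] {p : Ideal R}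
    (hp : p ∈ associatedPrimes R R) : p = maximalIdeal R := by
  by_contra hpm
  have := hp.1
  have hinj : HasInjectiveDimensionLT (of R R) 1 := inferInstance
  obtain ⟨-, f, hf⟩ := (isAssociatedPrime_iff_exists_injective_linearMap _ _).1 hp
  have h0 : Ext.mk₀ (ofHom f) = 0 := ext_quotient_prime_eq_zero _ _ hinj p hpm _
  have hf0 : f = 0 := by
    have h1 : ofHom f = 0 := (Ext.mk₀_bijective _ _).1 (h0.trans (Ext.mk₀_zero _ _).symm)
    exact congrArg ModuleCat.Hom.hom h1
  have : Nontrivial (R ⧸ p) := Ideal.Quotient.nontrivial_iff.2 this.ne_top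
  exact one_ne_zero (hf (by simp [hf0] : f 1 = f 0))

end ModuleCat

section changeOfRings

variable {R : Type u} [CommRing R] (x : R)

lemma Module.Injective.torsionBy (E : Type u) [AddCommGroup E] [Module R E]
    [Module.Injective R E] :
    Module.Injective (R ⧸ Ideal.span {x}) (Submodule.torsionBy R E x) where
  out X Y _ _ _ _ f hf g := by
    let := Module.compHom X (Ideal.Quotient.mk (Ideal.span {x}))
    let := Module.compHom Y (Ideal.Quotient.mk (Ideal.span {x}))
    have : IsScalarTower R (R ⧸ Ideal.span {x}) X :=
      ⟨fun a b c => mul_smul (Ideal.Quotient.mk _ a) b c⟩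
    have : IsScalarTower R (R ⧸ Ideal.span {x}) Y :=
      ⟨fun a b c => mul_smul (Ideal.Quotient.mk _ a) b c⟩
    obtain ⟨h, hh⟩ := Module.Injective.out (f.restrictScalars R) hf
      ((Submodule.torsionBy R E x).subtype ∘ₗ g.restrictScalars R)
    have hx (y : Y) : h y ∈ Submodule.torsionBy R E x := by
      have : x • y = 0 := by
        change Ideal.Quotient.mk (Ideal.span {x}) x • y = 0
        rw [Ideal.Quotient.eq_zero_iff_mem.2 (Ideal.mem_span_singleton_self x), zero_smul]
      rw [Submodule.mem_torsionBy_iff, ← map_smul, this, map_zero]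
    refine ⟨(h.codRestrict _ hx).extendScalarsOfSurjective Ideal.Quotient.mk_surjective,
      fun y => Subtype.ext (hh y)⟩

end changeOfRings

section changeOfRings

variable {R : Type u} [CommRing R] {x : R}

lemma Module.exists_injective_linearMap_injective (R : Type u) [CommRing R] (M : Type u)
    [AddCommGroup M] [Module R M] :
    ∃ (E : Type u) (_ : AddCommGroup E) (_ : Module R E) (f : M →ₗ[R] E),
      Module.Injective R E ∧ Function.Injective f :=
  let E : ModuleCat.{u} R := CategoryTheory.Injective.under (ModuleCat.of R M)
  have hE : CategoryTheory.Injective E := Injective.injective_under _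
  ⟨E, inferInstance, inferInstance, (Injective.ι (ModuleCat.of R M)).hom,
    (Module.injective_iff_injective_object R E).2 hE,
    (ModuleCat.mono_iff_injective _).1 (Injective.ι_mono _)⟩

lemma Module.Injective.exists_smul_eq (hx : IsSMulRegular R x) {E : Type u} [AddCommGroup E]
    [Module R E] [Module.Injective R E] (e : E) : ∃ e' : E, x • e' = e := by
  obtain ⟨h, hh⟩ := Module.Injective.out (R := R) (LinearMap.lsmul R R x) hx
    (LinearMap.toSpanSingleton R E e)
  refine ⟨h 1, ?_⟩
  have := hh 1
  simpa [← map_smul] using this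

/-- The map induced by a linear map on `x`-torsion submodules, as modules over `R ⧸ (x)`. -/
def LinearMap.torsionByMap (x : R) {M N : Type*} [AddCommGroup M] [Module R M] [AddCommGroup N]
    [Module R N] (f : M →ₗ[R] N) :
    Submodule.torsionBy R M x →ₗ[R ⧸ Ideal.span {x}] Submodule.torsionBy R N x :=
  (f.restrict (p := Submodule.torsionBy R M x) (q := Submodule.torsionBy R N x) fun m hm => by
    rw [Submodule.mem_torsionBy_iff] at hm ⊢
    rw [← map_smul, hm, map_zero]).extendScalarsOfSurjective Ideal.Quotient.mk_surjective

lemma LinearMap.coe_torsionByMap {M N : Type*} [AddCommGroup M] [Module R M] [AddCommGroup N]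
    [Module R N] (f : M →ₗ[R] N) (m : Submodule.torsionBy R M x) :
    (f.torsionByMap x m : N) = f m := rfl

lemma LinearMap.torsionByMap_injective {M N : Type*} [AddCommGroup M] [Module R M]
    [AddCommGroup N] [Module R N] {f : M →ₗ[R] N} (hf : Function.Injective f) :
    Function.Injective (f.torsionByMap x) := fun _ _ h =>
  Subtype.ext (hf (congrArg Subtype.val h))

lemma LinearMap.torsionByMap_exact {M N P : Type*} [AddCommGroup M] [Module R M]
    [AddCommGroup N] [Module R N] [AddCommGroup P] [Module R P] {f : M →ₗ[R] N} {g : N →ₗ[R] P}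
    (hf : Function.Injective f) (hfg : Function.Exact f g) :
    Function.Exact (f.torsionByMap x) (g.torsionByMap x) := by
  intro a
  rw [Subtype.ext_iff, g.coe_torsionByMap, ZeroMemClass.coe_zero, hfg]
  constructor
  · rintro ⟨m, hm⟩
    refine ⟨⟨m, ?_⟩, Subtype.ext hm⟩
    rw [Submodule.mem_torsionBy_iff]
    apply hf
    rw [map_smul, hm, map_zero]
    exact a.2
  · rintro ⟨m, hm⟩
    exact ⟨m, congrArg Subtype.val hm⟩

lemma LinearMap.torsionByMap_surjective {M N P : Type*} [AddCommGroup M] [Module R M]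
    [AddCommGroup N] [Module R N] [AddCommGroup P] [Module R P] {f : M →ₗ[R] N} {g : N →ₗ[R] P}
    (hg : Function.Surjective g) (hfg : Function.Exact f g)
    (hM : ∀ m : M, ∃ m', x • m' = m) :
    Function.Surjective (g.torsionByMap x) := by
  rintro ⟨p, hp⟩
  obtain ⟨a, rfl⟩ := hg p
  rw [Submodule.mem_torsionBy_iff, ← map_smul, hfg] at hp
  obtain ⟨m, hm⟩ := hp
  obtain ⟨m', rfl⟩ := hM m
  refine ⟨⟨a - f m', ?_⟩, Subtype.ext ?_⟩
  · rw [Submodule.mem_torsionBy_iff, smul_sub, ← hm, map_smul, sub_self]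
  · simp [LinearMap.coe_torsionByMap, hfg.apply_apply_eq_zero]

namespace ModuleCat

lemma hasInjectiveDimensionLT_torsionBy (hx : IsSMulRegular R x) (n : ℕ) (C : Type u)
    [AddCommGroup C] [Module R C] (hC : ∀ c : C, ∃ c', x • c' = c)
    (h : HasInjectiveDimensionLT (of R C) n) :
    HasInjectiveDimensionLT (of (R ⧸ Ideal.span {x}) (Submodule.torsionBy R C x)) n := by
  induction n using Nat.twoStepInduction generalizing C with
  | zero =>
    rw [hasInjectiveDimensionLT_zero_iff_isZero, isZero_of_iff_subsingleton] at h ⊢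
    infer_instance
  | one =>
    rw [← injective_iff_hasInjectiveDimensionLT_one, ← Module.injective_iff_injective_object] at h ⊢
    exact .torsionBy x C
  | more n _ ih =>
    obtain ⟨E, _, _, f, hE, hf⟩ := Module.exists_injective_linearMap_injective R C
    have hfg := LinearMap.exact_map_mkQ_range f
    have hg := (LinearMap.range f).mkQ_surjective
    have hS := shortExact_of_exact f _ hf hg hfg
    have hS' := shortExact_of_exact _ _ (f.torsionByMap_injective (x := x) hf)
      (LinearMap.torsionByMap_surjective hg hfg hC) (f.torsionByMap_exact hf hfg)
    have hE' : Module.Injective (R ⧸ Ideal.span {x}) (Submodule.torsionBy R E x) := .torsionBy x E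
    rw [Module.injective_iff_injective_object] at hE hE'
    refine (hS'.hasInjectiveDimensionLT_X₃_iff n hE').1 (ih _ ?_
      ((hS.hasInjectiveDimensionLT_X₃_iff n hE).2 h))
    intro c
    obtain ⟨e, rfl⟩ := hg c
    rw [← Module.injective_iff_injective_object] at hE
    obtain ⟨e', rfl⟩ := Module.Injective.exists_smul_eq hx e
    exact ⟨_, (map_smul _ _ _).symm⟩

lemma exists_hasInjectiveDimensionLT_quotient (hx : IsSMulRegular R x)
    (h : ∃ n, HasInjectiveDimensionLT (of R R) n) :
    ∃ n, HasInjectiveDimensionLT (of (R ⧸ Ideal.span {x}) (R ⧸ Ideal.span {x})) n := by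
  obtain ⟨n, h⟩ := h
  have h := hasInjectiveDimensionLT_of_ge (of R R) n (n + 2) (by lia)
  obtain ⟨E, _, _, f, hE, hf⟩ := Module.exists_injective_linearMap_injective R R
  have hfg := LinearMap.exact_map_mkQ_range f
  have hg := (LinearMap.range f).mkQ_surjective
  have hS := shortExact_of_exact f _ hf hg hfg
  have hC := hasInjectiveDimensionLT_torsionBy hx (n + 1) (E ⧸ LinearMap.range f) (fun c => by
    obtain ⟨e, rfl⟩ := hg c
    obtain ⟨e', rfl⟩ := Module.Injective.exists_smul_eq hx e
    exact ⟨_, (map_smul _ _ _).symm⟩) ((hS.hasInjectiveDimensionLT_X₃_iff n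
      ((Module.injective_iff_injective_object R E).1 hE)).2 h)
  have hE' : Module.Injective (R ⧸ Ideal.span {x}) (Submodule.torsionBy R E x) := .torsionBy x E
  rw [Module.injective_iff_injective_object] at hE'
  have hE'' :
      HasInjectiveDimensionLT (of (R ⧸ Ideal.span {x}) (Submodule.torsionBy R E x)) (n + 2) :=
    hasInjectiveDimensionLT_of_ge _ 1 (n + 2) (by lia)
  let g := (LinearMap.range f).mkQ.torsionByMap x
  have hginj : Function.Injective g := by
    rw [injective_iff_map_eq_zero]
    intro e he
    obtain ⟨r, rfl⟩ := (f.torsionByMap_exact hf hfg e).1 he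
    have hr : r = 0 := Subtype.ext (hx (r.2.trans (smul_zero x).symm))
    rw [hr, map_zero]
  have hS' := shortExact_of_exact g _ hginj (LinearMap.range g).mkQ_surjective
    (LinearMap.exact_map_mkQ_range g)
  have hQ := hS'.hasInjectiveDimensionLT_X₃ (n + 1) hC hE''
  obtain ⟨e₁, he₁⟩ := Module.Injective.exists_smul_eq hx (f 1)
  let c₁ : Submodule.torsionBy R (E ⧸ LinearMap.range f) x :=
    ⟨(LinearMap.range f).mkQ e₁, by
      rw [Submodule.mem_torsionBy_iff, ← map_smul, he₁]
      exact hfg.apply_apply_eq_zero 1⟩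
  let φ := (LinearMap.range g).mkQ ∘ₗ LinearMap.toSpanSingleton (R ⧸ Ideal.span {x}) _ c₁
  have hφ : Function.Bijective φ := by
    constructor
    · rw [injective_iff_map_eq_zero]
      intro y hy
      obtain ⟨r, rfl⟩ := Ideal.Quotient.mk_surjective y
      obtain ⟨e, he⟩ := (Submodule.Quotient.mk_eq_zero _).1 hy
      have he : (LinearMap.range f).mkQ e = (LinearMap.range f).mkQ (r • e₁) :=
        congrArg Subtype.val he
      obtain ⟨s, hs⟩ := (hfg (r • e₁ - e)).1 (by rw [map_sub, he, sub_self])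
      have hex : x • (e : E) = 0 := e.2
      rw [Ideal.Quotient.eq_zero_iff_mem, Ideal.mem_span_singleton]
      refine ⟨s, hf ?_⟩
      rw [← smul_eq_mul, map_smul, hs, smul_sub, hex, smul_comm, he₁, ← map_smul, smul_eq_mul,
        mul_one, sub_zero]
    · intro q
      obtain ⟨⟨c, hc⟩, rfl⟩ := (LinearMap.range g).mkQ_surjective q
      obtain ⟨e, rfl⟩ := hg c
      rw [Submodule.mem_torsionBy_iff, ← map_smul, hfg] at hc
      obtain ⟨r, hr⟩ := hc
      refine ⟨Ideal.Quotient.mk _ r, ?_⟩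
      refine (Submodule.Quotient.eq _).2 ⟨⟨r • e₁ - e, ?_⟩, Subtype.ext ?_⟩
      · rw [Submodule.mem_torsionBy_iff, smul_sub, smul_comm, he₁, ← hr, ← map_smul, smul_eq_mul,
          mul_one, sub_self]
      · exact (map_sub (LinearMap.range f).mkQ _ _).trans
          (congrArg (· - _) (map_smul (LinearMap.range f).mkQ _ _))
  exact ⟨n + 1,
    hasInjectiveDimensionLT_of_iso (LinearEquiv.ofBijective φ hφ).toModuleIso.symm (n + 1)⟩

end ModuleCat
end changeOfRings

section changeOfRings

variable {R : Type u} [CommRing R] {x : R}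

namespace ModuleCat

lemma hasInjectiveDimensionLT_two_of_injective_quotient (hx : IsSMulRegular R x) (M : Type u)
    [AddCommGroup M] [Module R M] [Module (R ⧸ Ideal.span {x}) M]
    [IsScalarTower R (R ⧸ Ideal.span {x}) M] [Module.Injective (R ⧸ Ideal.span {x}) M] :
    HasInjectiveDimensionLT (of R M) 2 := by
  obtain ⟨E, _, _, f, hE, hf⟩ := Module.exists_injective_linearMap_injective R M
  have hfx (m : M) : f m ∈ Submodule.torsionBy R E x := by
    rw [Submodule.mem_torsionBy_iff, ← map_smul, ← algebraMap_smul (R ⧸ Ideal.span {x}),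
      Ideal.Quotient.algebraMap_eq,
      Ideal.Quotient.eq_zero_iff_mem.2 (Ideal.mem_span_singleton_self x), zero_smul, map_zero]
  let g := (f.codRestrict _ hfx).extendScalarsOfSurjective
    (Ideal.Quotient.mk_surjective (I := Ideal.span {x}))
  obtain ⟨r, hr⟩ := Module.Injective.out (R := R ⧸ Ideal.span {x}) g
    (fun _ _ h => hf (congrArg Subtype.val h)) LinearMap.id
  have hretract : Retract (of R M) (of R (Submodule.torsionBy R E x)) :=
    { i := ofHom (f.codRestrict _ hfx)
      r := ofHom (r.restrictScalars R)
      retract := by ext m; exact hr m }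
  have hS := shortExact_of_exact (Submodule.torsionBy R E x).subtype (LinearMap.lsmul R E x)
    (Submodule.subtype_injective _) (Module.Injective.exists_smul_eq hx)
    (LinearMap.exact_iff.2 (by rw [Submodule.range_subtype]; rfl))
  have hE' : Injective (of R E) := (Module.injective_iff_injective_object R E).1 hE
  have := (hS.hasInjectiveDimensionLT_X₃_iff 0 hE').1
    (inferInstanceAs (HasInjectiveDimensionLT (of R E) 1))
  exact hretract.hasInjectiveDimensionLT 2

lemma hasInjectiveDimensionLT_succ_of_quotient (hx : IsSMulRegular R x) (n : ℕ) (M : Type u)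
    [AddCommGroup M] [Module R M] [Module (R ⧸ Ideal.span {x}) M]
    [IsScalarTower R (R ⧸ Ideal.span {x}) M]
    (h : HasInjectiveDimensionLT (of (R ⧸ Ideal.span {x}) M) n) :
    HasInjectiveDimensionLT (of R M) (n + 1) := by
  induction n using Nat.twoStepInduction generalizing M with
  | zero =>
    have hM : HasInjectiveDimensionLT (of R M) 0 := by
      rw [hasInjectiveDimensionLT_zero_iff_isZero, isZero_of_iff_subsingleton] at h ⊢
      exact h
    exact hasInjectiveDimensionLT_of_ge _ 0 1 zero_le_one
  | one =>
    rw [← injective_iff_hasInjectiveDimensionLT_one, ← Module.injective_iff_injective_object] at h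
    exact hasInjectiveDimensionLT_two_of_injective_quotient hx M
  | more n _ ih =>
    obtain ⟨E, _, _, f, hE, hf⟩ :=
      Module.exists_injective_linearMap_injective (R ⧸ Ideal.span {x}) M
    let := Module.compHom E (Ideal.Quotient.mk (Ideal.span {x}))
    have : IsScalarTower R (R ⧸ Ideal.span {x}) E :=
      ⟨fun a b c => mul_smul (Ideal.Quotient.mk _ a) b c⟩
    have hfg := LinearMap.exact_map_mkQ_range f
    have hg := (LinearMap.range f).mkQ_surjective
    have hS := shortExact_of_exact f _ hf hg hfg
    have hS' := shortExact_of_exact (f.restrictScalars R)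
      ((LinearMap.range f).mkQ.restrictScalars R) hf hg hfg
    have h2 := hasInjectiveDimensionLT_two_of_injective_quotient hx E
    rw [Module.injective_iff_injective_object] at hE
    exact hS'.hasInjectiveDimensionLT_X₁ (n + 2) (ih _
      ((hS.hasInjectiveDimensionLT_X₃_iff n hE).2 h))
      (hasInjectiveDimensionLT_of_ge _ 2 (n + 3) (by lia))

lemma exists_hasInjectiveDimensionLT_of_quotient [IsNoetherianRing R] [IsLocalRing R]
    (hxm : x ∈ maximalIdeal R) (hx : IsSMulRegular R x)
    (h : ∃ n, HasInjectiveDimensionLT (of (R ⧸ Ideal.span {x}) (R ⧸ Ideal.span {x})) n) :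
    ∃ n, HasInjectiveDimensionLT (of R R) n := by
  obtain ⟨n, h⟩ := h
  have h := hasInjectiveDimensionLT_succ_of_quotient hx n _ h
  have hS := shortExact_of_exact (LinearMap.lsmul R R x) (Ideal.span {x}).mkQ hx
    (Submodule.mkQ_surjective _) (LinearMap.exact_iff.2 (by
      rw [Submodule.ker_mkQ]
      ext y
      simp [Ideal.mem_span_singleton, dvd_def, eq_comm]))
  refine ⟨n + 2, hasInjectiveDimensionLT_of_ext_quotient _ _ fun I =>
    ext_eq_zero_of_smul_surjective _ _ _ hxm fun e => ?_⟩
  obtain ⟨e', he'⟩ := Ext.covariant_sequence_exact₂ _ hS e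
    (Ext.eq_zero_of_hasInjectiveDimensionLT _ (n + 1) (by lia))
  refine ⟨e', ?_⟩
  rw [← he']
  have hx1 : ofHom (LinearMap.lsmul R R x) = x • 𝟙 (of R R) := rfl
  change x • e' = e'.comp (Ext.mk₀ (ofHom (LinearMap.lsmul R R x))) _
  rw [hx1, Ext.mk₀_smul, Ext.comp_smul, Ext.comp_mk₀_id]

end ModuleCat
end changeOfRings

section dimensionZero

variable {R : Type u} [CommRing R]

lemma LinearMap.length_ker_add_length_range {M N : Type*} [AddCommGroup M] [Module R M]
    [AddCommGroup N] [Module R N] (f : M →ₗ[R] N) :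
    Module.length R (LinearMap.ker f) + Module.length R (LinearMap.range f) =
      Module.length R M :=
  (Module.length_eq_add_of_exact (LinearMap.ker f).subtype f.rangeRestrict
    (Submodule.subtype_injective _) f.surjective_rangeRestrict fun x => by
      rw [Submodule.coe_subtype, Subtype.range_coe, SetLike.mem_coe, ← f.ker_rangeRestrict,
        LinearMap.mem_ker]).symm

variable [IsLocalRing R]

lemma IsIrreducibleIdeal.length_linearMap_residue_le_one
    (h : IsIrreducibleIdeal (⊥ : Ideal R)) :
    Module.length R (R ⧸ maximalIdeal R →ₗ[R] R) ≤ 1 := by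
  rcases subsingleton_or_nontrivial (R ⧸ maximalIdeal R →ₗ[R] R) with _ | _
  · rw [Module.length_eq_zero]
    exact zero_le_one
  obtain ⟨f, hf⟩ := exists_ne (0 : R ⧸ maximalIdeal R →ₗ[R] R)
  have ext_one {f g : R ⧸ maximalIdeal R →ₗ[R] R} (h : f 1 = g 1) : f = g := by
    ext
    exact h
  have mul_one_eq_zero (g : R ⧸ maximalIdeal R →ₗ[R] R) (r) (hr : r ∈ maximalIdeal R) :
      r * g 1 = 0 := by
    have h0 : r • (1 : R ⧸ maximalIdeal R) = 0 := by
      rw [← Algebra.algebraMap_eq_smul_one, Ideal.Quotient.algebraMap_eq,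
        Ideal.Quotient.eq_zero_iff_mem]
      exact hr
    rw [← smul_eq_mul, ← map_smul, h0, map_zero]
  have hsurj : Function.Surjective (Submodule.liftQ (maximalIdeal R)
      (LinearMap.toSpanSingleton R (R ⧸ maximalIdeal R →ₗ[R] R) f) fun r hr =>
        ext_one (mul_one_eq_zero f r hr)) := by
    intro g
    by_cases hg : g = 0
    · exact ⟨0, by rw [map_zero, hg]⟩
    have hfg : Ideal.span {f 1} ⊓ Ideal.span {g 1} ≠ ⊥ := by
      intro h0
      rcases h.2 _ _ h0.symm with h | h
      · exact hf (ext_one (Ideal.span_singleton_eq_bot.1 h.symm))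
      · exact hg (ext_one (Ideal.span_singleton_eq_bot.1 h.symm))
    obtain ⟨y, ⟨hyf, hyg⟩, hy⟩ := Submodule.exists_mem_ne_zero_of_ne_bot hfg
    obtain ⟨a, rfl⟩ := Ideal.mem_span_singleton'.1 hyf
    obtain ⟨b, hb⟩ := Ideal.mem_span_singleton'.1 hyg
    have hbu : IsUnit b := by
      rw [← IsLocalRing.notMem_maximalIdeal]
      intro hbm
      exact hy (hb ▸ mul_one_eq_zero g b hbm)
    obtain ⟨c, hc⟩ := hbu.exists_left_inv
    refine ⟨Ideal.Quotient.mk _ (c * a), ext_one ?_⟩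
    change (c * a) * f 1 = g 1
    rw [mul_assoc, ← hb, ← mul_assoc, hc, one_mul]
  refine (Module.length_le_of_surjective _ hsurj).trans_eq ?_
  rw [Module.length_eq_one_iff]
  exact isSimpleModule_iff_isCoatom.2 (maximalIdeal.isMaximal R).out

variable [IsNoetherianRing R] [Ring.KrullDimLE 0 R]

lemma IsIrreducibleIdeal.length_linearMap_le (h : IsIrreducibleIdeal (⊥ : Ideal R)) (M : Type u)
    [AddCommGroup M] [Module R M] [Module.Finite R M] :
    Module.length R (M →ₗ[R] R) ≤ Module.length R M := by
  induction ‹Module.Finite R M› using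
    IsNoetherianRing.induction_on_isQuotientEquivQuotientPrime R with
  | subsingleton N => simp
  | quotient N p e =>
    have hp : p.1 = maximalIdeal R := Ring.KrullDimLE.eq_maximalIdeal_of_isPrime _
    rw [hp] at e
    rw [e.length_eq, (LinearEquiv.congrLeft R R e).length_eq]
    refine h.length_linearMap_residue_le_one.trans ?_
    rw [Order.one_le_iff_ne_zero]
    have : Nontrivial (R ⧸ maximalIdeal R) := inferInstance
    exact Module.length_pos.ne'
  | exact N₁ N₂ N₃ f g hf hg hfg h₁ h₃ =>
    rw [Module.length_eq_add_of_exact f g hf hg hfg,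
      ← (f.lcomp R R).length_ker_add_length_range, add_comm]
    refine add_le_add ((Module.length_le_of_injective (Submodule.subtype _)
      (Submodule.subtype_injective _)).trans h₁) (le_trans ?_ h₃)
    rw [LinearMap.exact_iff.1 (LinearMap.exact_lcomp_of_exact_of_surjective R hfg hg)]
    exact Module.length_le_of_surjective _ (LinearMap.surjective_rangeRestrict _)

lemma IsIrreducibleIdeal.injective (h : IsIrreducibleIdeal (⊥ : Ideal R)) :
    Module.Injective R R := by
  have : IsArtinianRing R := IsNoetherianRing.isArtinianRing_of_krullDimLE_zero
  rw [← Module.Baer.iff_injective]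
  intro I φ
  let ρ : R →ₗ[R] (I →ₗ[R] R) := LinearMap.toSpanSingleton R _ I.subtype
  have hker : Module.length R (LinearMap.ker ρ) ≤ Module.length R (R ⧸ I) := by
    refine le_trans ?_ (h.length_linearMap_le (R ⧸ I))
    let τ : LinearMap.ker ρ →ₗ[R] (R ⧸ I →ₗ[R] R) :=
      { toFun r := Submodule.liftQ I (LinearMap.toSpanSingleton R R r) fun i hi => by
          have : i • (r : R) = 0 := (mul_comm _ _).trans (LinearMap.congr_fun r.2 ⟨i, hi⟩)
          exact this
        map_add' a b := by
          refine Submodule.linearMap_qext _ (LinearMap.ext fun s => ?_)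
          exact smul_add s (a : R) b
        map_smul' a b := by
          refine Submodule.linearMap_qext _ (LinearMap.ext fun s => ?_)
          exact smul_comm s a (b : R) }
    refine Module.length_le_of_injective τ fun a b hab => Subtype.ext ?_
    have : (1 : R) • (a : R) = (1 : R) • (b : R) := LinearMap.congr_fun hab (Ideal.Quotient.mk I 1)
    simpa using this
  have h1 := ρ.length_ker_add_length_range
  have h2 : Module.length R R = Module.length R I + Module.length R (R ⧸ I) :=
    Module.length_eq_add_of_exact I.subtype I.mkQ I.injective_subtype I.mkQ_surjective
      (LinearMap.exact_subtype_mkQ I)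
  have hρ : LinearMap.range ρ = ⊤ := by
    by_contra hne
    have h3 := Submodule.length_lt hne
    have h4 := h.length_linearMap_le I
    have h5 := h1.trans h2
    have h6 : Module.length R (R ⧸ I) ≠ ⊤ := Module.length_ne_top
    refine (((add_le_add_left hker _).trans_lt
      (ENat.add_lt_add_of_le_of_lt h6 le_rfl (h3.trans_le h4))).trans_eq (add_comm _ _)).ne h5
  obtain ⟨r, hr⟩ := LinearMap.range_eq_top.1 hρ φ
  refine ⟨LinearMap.toSpanSingleton R R r, fun x hx => ?_⟩
  rw [← hr]
  simp [ρ, mul_comm]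

lemma Module.Injective.isIrreducibleIdeal_bot [Module.Injective R R] :
    IsIrreducibleIdeal (⊥ : Ideal R) := by
  refine ⟨bot_ne_top, fun J K hJK => ?_⟩
  by_contra! hne
  have key (J : Ideal R) (hJ : ⊥ ≠ J) : ∃ a ∈ J, a ≠ 0 ∧ ∀ r, r * a = 0 ↔ r ∈ maximalIdeal R := by
    have : Nontrivial J := Submodule.nontrivial_iff_ne_bot.2 hJ.symm
    obtain ⟨p, hp⟩ := associatedPrimes.nonempty R J
    have := hp.isPrime
    obtain rfl : p = maximalIdeal R := Ring.KrullDimLE.eq_maximalIdeal_of_isPrime _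
    obtain ⟨-, f, hf⟩ := (isAssociatedPrime_iff_exists_injective_linearMap _ _).1 hp
    have hr (r : R) : r * f 1 = 0 ↔ r ∈ maximalIdeal R := by
      rw [← Ideal.Quotient.eq_zero_iff_mem, ← map_eq_zero_iff f hf, ← Ideal.Quotient.algebraMap_eq,
        Algebra.algebraMap_eq_smul_one, map_smul, Subtype.ext_iff]
      rfl
    refine ⟨f 1, (f 1).2, fun h0 => ?_, hr⟩
    exact (Ideal.ne_top_iff_one _).1 (Ideal.IsPrime.ne_top inferInstance)
      ((hr 1).1 (by rw [h0, mul_zero]))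
  obtain ⟨a, haJ, ha0, ha⟩ := key J hne.1
  obtain ⟨b, hbK, hb0, hb⟩ := key K hne.2
  have hk : LinearMap.ker (LinearMap.toSpanSingleton R R a) =
      LinearMap.ker (LinearMap.toSpanSingleton R R b) := by
    ext r
    simp [ha, hb]
  obtain ⟨h, hh⟩ := Module.Injective.out (R := R) (Q := R)
    (Submodule.liftQ _ (LinearMap.toSpanSingleton R R a) le_rfl)
    (LinearMap.ker_eq_bot.1 (Submodule.ker_liftQ_eq_bot' _ _ rfl))
    (Submodule.liftQ _ (LinearMap.toSpanSingleton R R b) hk.le)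
  have hab : h a = b := by
    have := hh (Submodule.Quotient.mk 1)
    rwa [Submodule.liftQ_apply, Submodule.liftQ_apply, LinearMap.toSpanSingleton_apply_one,
      LinearMap.toSpanSingleton_apply_one] at this
  refine hb0 ((Submodule.mem_bot R).1 (hJK ▸ ⟨?_, hbK⟩))
  rw [← hab, ← mul_one a, ← smul_eq_mul, map_smul, smul_eq_mul]
  exact J.mul_mem_right _ haJ

end dimensionZero

section parameterIdeals

variable {R : Type u} [CommRing R]

lemma IsIrreducibleIdeal.comap {S : Type v} [CommRing S] {f : R →+* S}
    (hf : Function.Surjective f) {I : Ideal S} (hI : IsIrreducibleIdeal I) :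
    IsIrreducibleIdeal (I.comap f) := by
  refine ⟨Ideal.comap_ne_top f hI.1, fun J K h => ?_⟩
  have hker : RingHom.ker f ≤ I.comap f := Ideal.comap_mono bot_le
  have key (L : Ideal R) (hL : I.comap f ≤ L) : (L.map f).comap f = L := by
    rw [Ideal.comap_map_of_surjective' f hf, sup_eq_left.2 (hker.trans hL)]
  have hJ := key J (h ▸ inf_le_left)
  have hK := key K (h ▸ inf_le_right)
  have : I = J.map f ⊓ K.map f := by
    apply Ideal.comap_injective_of_surjective f hf
    rw [Ideal.comap_inf, hJ, hK, h]
  rcases hI.2 _ _ this with h1 | h1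
  · exact .inl (by rw [h1, hJ])
  · exact .inr (by rw [h1, hK])

lemma IsIrreducibleIdeal.of_comap {S : Type v} [CommRing S] {f : R →+* S}
    (hf : Function.Surjective f) {I : Ideal S} (hI : IsIrreducibleIdeal (I.comap f)) :
    IsIrreducibleIdeal I := by
  refine ⟨fun h => hI.1 (by rw [h, Ideal.comap_top]), fun J K h => ?_⟩
  have hinj := Ideal.comap_injective_of_surjective f hf
  exact (hI.2 _ _ (by rw [h, Ideal.comap_inf])).imp (fun h => hinj h) fun h => hinj h

lemma Ideal.map_quotient_mk_span_range_eq {d : ℕ} (J : Ideal R) (a : Fin (d + 1) → R)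
    (ha : a 0 ∈ J) : (span (Set.range a)).map (Ideal.Quotient.mk J) =
      span (Set.range (Ideal.Quotient.mk J ∘ Fin.tail a)) := by
  rw [map_span, ← Set.range_comp, ← Fin.cons_self_tail a, Fin.comp_cons, Fin.range_cons,
    Ideal.Quotient.eq_zero_iff_mem.2 ha, span_insert_zero, Fin.tail_cons]

lemma isSMulRegular_iff_forall_notMem_associatedPrimes [IsNoetherianRing R] {x : R} :
    IsSMulRegular R x ↔ ∀ p ∈ associatedPrimes R R, x ∉ p := by
  have h := Set.ext_iff.1 (biUnion_associatedPrimes_eq_zero_divisors R R) x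
  simp only [Set.mem_iUnion, SetLike.mem_coe, Set.mem_ofPred_eq, exists_prop] at h
  rw [isSMulRegular_iff_right_eq_zero_of_smul, ← not_iff_not]
  push Not
  rw [h]
  simp only [and_comm]

variable [IsLocalRing R]

lemma Ideal.Quotient.isLocalRing_of_ne_top {I : Ideal R} (hI : I ≠ ⊤) : IsLocalRing (R ⧸ I) :=
  have := Ideal.Quotient.nontrivial_iff.2 hI
  IsLocalRing.of_surjective' (Ideal.Quotient.mk I) Ideal.Quotient.mk_surjective

lemma Ideal.radical_eq_maximalIdeal_of_forall {I : Ideal R} (hI : I ≤ maximalIdeal R)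
    (h : ∀ x ∈ maximalIdeal R, x ∈ I.radical) : I.radical = maximalIdeal R :=
  le_antisymm ((maximalIdeal.isMaximal R).isPrime.radical_le_iff.2 hI) h

lemma Ideal.comap_maximalIdeal_of_surjective {S : Type v} [CommRing S] [IsLocalRing S]
    {f : R →+* S} (hf : Function.Surjective f) :
    (maximalIdeal S).comap f = maximalIdeal R :=
  have := Ideal.comap_isMaximal_of_surjective f hf (K := maximalIdeal S)
  eq_maximalIdeal this

lemma Ideal.radical_map_eq_maximalIdeal {S : Type v} [CommRing S] [IsLocalRing S] {f : R →+* S}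
    (hf : Function.Surjective f) {I : Ideal R} (hI : I.radical = maximalIdeal R) :
    (I.map f).radical = maximalIdeal S := by
  have hfm := Ideal.comap_maximalIdeal_of_surjective hf
  refine radical_eq_maximalIdeal_of_forall (map_le_iff_le_comap.2 ?_) fun y hy => ?_
  · rw [hfm, ← hI]
    exact le_radical
  · obtain ⟨x, rfl⟩ := hf y
    rw [← mem_comap, hfm, ← hI] at hy
    exact map_radical_le f (mem_map_of_mem f hy)

lemma ringKrullDim_le_of_radical_span_range [IsNoetherianRing R] {d : ℕ} {a : Fin d → R}
    (ha : (Ideal.span (Set.range a)).radical = maximalIdeal R) : ringKrullDim R ≤ d := by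
  have hmin : maximalIdeal R ∈ (Ideal.span (Set.range a)).minimalPrimes := by
    rw [← Ideal.radical_minimalPrimes, ha, Ideal.minimalPrimes_eq_subsingleton_self]
    rfl
  have hle := Ideal.height_le_card_of_mem_minimalPrimes_span (Set.finite_range a) hmin
  have hcard : (Set.range a).ncard ≤ d := by
    simpa using Set.ncard_image_le (f := a) (s := Set.univ) Set.finite_univ
  rw [← maximalIdeal_height_eq_ringKrullDim]
  exact_mod_cast hle.trans (by exact_mod_cast hcard)

lemma exists_radical_span_range_eq_maximalIdeal [IsNoetherianRing R] {d : ℕ}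
    (hd : ringKrullDim R = d) : ∃ a : Fin d → R, (∀ i, a i ∈ maximalIdeal R) ∧
      (Ideal.span (Set.range a)).radical = maximalIdeal R := by
  obtain ⟨s, hs, hcard⟩ :=
    Ideal.exists_finset_card_eq_height_of_isNoetherianRing (maximalIdeal R)
  have hsd : s.card = d := by
    rw [← maximalIdeal_height_eq_ringKrullDim, ← hcard] at hd
    exact_mod_cast hd
  let e := s.equivFinOfCardEq hsd
  have hrange : Set.range (fun i => (e.symm i : R)) = s := by
    ext y
    refine ⟨?_, fun hy => ⟨e ⟨y, hy⟩, by simp⟩⟩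
    rintro ⟨i, rfl⟩
    exact (e.symm i).2
  refine ⟨fun i => e.symm i, fun i => hs.1.2 (Ideal.subset_span (e.symm i).2), ?_⟩
  rw [hrange]
  refine Ideal.radical_eq_maximalIdeal_of_forall hs.1.2 fun x hx => ?_
  rw [Ideal.radical_eq_sInf, Ideal.mem_sInf]
  rintro J ⟨hJ, hJp⟩
  exact hs.2 ⟨hJp, hJ⟩ (le_maximalIdeal hJp.ne_top) hx

variable [IsNoetherianRing R] {x : R}

lemma IsParameterIdeal.comap_quotient_mk [IsLocalRing (R ⧸ Ideal.span {x})]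
    (hxm : x ∈ maximalIdeal R) (hx : IsSMulRegular R x) {I : Ideal (R ⧸ Ideal.span {x})}
    (hI : IsParameterIdeal (R ⧸ Ideal.span {x}) I) :
    IsParameterIdeal R (I.comap (Ideal.Quotient.mk (Ideal.span {x}))) := by
  obtain ⟨d, b, hd, hbm, hIb, hrad⟩ := hI
  have hsurj := Ideal.Quotient.mk_surjective (I := Ideal.span {x})
  have hmax := Ideal.comap_maximalIdeal_of_surjective hsurj
  choose a ha using fun i => hsurj (b i)
  obtain rfl : Ideal.Quotient.mk _ ∘ a = b := funext ha
  refine ⟨d + 1, Fin.cons x a, ?_, ?_, ?_, ?_⟩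
  · rw [← ringKrullDim_quotient_span_singleton_succ_eq_ringKrullDim hx hxm, hd]
    rfl
  · rw [Fin.forall_fin_succ]
    refine ⟨hxm, fun i => ?_⟩
    rw [Fin.cons_succ, ← hmax]
    exact hbm i
  · rw [hIb, Set.range_comp, ← Ideal.map_span, Ideal.comap_map_of_surjective' _ hsurj,
      Ideal.mk_ker, Fin.range_cons, Ideal.span_insert, sup_comm]
  · rw [← Ideal.comap_radical, hrad, hmax]

lemma ringKrullDim_quotient_span_singleton_eq (hxm : x ∈ maximalIdeal R)
    (hx : IsSMulRegular R x) {d : ℕ} (hd : ringKrullDim R = (d + 1 : ℕ)) :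
    ringKrullDim (R ⧸ Ideal.span {x}) = d := by
  have := ringKrullDim_quotient_span_singleton_succ_eq_ringKrullDim hx hxm
  rw [hd, Nat.cast_add, Nat.cast_one] at this
  exact ENat.WithBot.add_one_cancel.1 this

lemma isParameterIdeal_map_quotient_mk {d : ℕ} {a : Fin (d + 1) → R}
    [IsLocalRing (R ⧸ Ideal.span {a 0})] (hd : ringKrullDim R = (d + 1 : ℕ))
    (ham : ∀ i, a i ∈ maximalIdeal R)
    (hrad : (Ideal.span (Set.range a)).radical = maximalIdeal R) (ha : IsSMulRegular R (a 0)) :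
    IsParameterIdeal (R ⧸ Ideal.span {a 0})
      ((Ideal.span (Set.range a)).map (Ideal.Quotient.mk (Ideal.span {a 0}))) := by
  have hsurj := Ideal.Quotient.mk_surjective (I := Ideal.span {a 0})
  refine ⟨d, Ideal.Quotient.mk _ ∘ Fin.tail a,
    ringKrullDim_quotient_span_singleton_eq (ham 0) ha hd, fun i => ?_,
    Ideal.map_quotient_mk_span_range_eq _ a (Ideal.mem_span_singleton_self _),
    Ideal.radical_map_eq_maximalIdeal hsurj hrad⟩
  have := ham i.succ
  rwa [← Ideal.comap_maximalIdeal_of_surjective hsurj] at this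

lemma ringKrullDim_quotient_le_of_radical_span_range {d : ℕ} {a : Fin (d + 1) → R}
    (hrad : (Ideal.span (Set.range a)).radical = maximalIdeal R) {p : Ideal R} (hp : p ≠ ⊤)
    (ha : a 0 ∈ p) : ringKrullDim (R ⧸ p) ≤ d := by
  have := Ideal.Quotient.isLocalRing_of_ne_top hp
  apply ringKrullDim_le_of_radical_span_range
  rw [← Ideal.map_quotient_mk_span_range_eq p a ha]
  exact Ideal.radical_map_eq_maximalIdeal Ideal.Quotient.mk_surjective hrad

variable (R) in
lemma exists_isSMulRegular_or_exists_socle :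
    (∃ x ∈ maximalIdeal R, IsSMulRegular R x) ∨
      ∃ w : R, w ≠ 0 ∧ ∀ r ∈ maximalIdeal R, r * w = 0 := by
  by_contra! h
  obtain ⟨h, h'⟩ := h
  have hsub : (maximalIdeal R : Set R) ⊆ ⋃ p ∈ associatedPrimes R R, (p : Set R) := by
    intro x hx
    have := h x hx
    rw [isSMulRegular_iff_forall_notMem_associatedPrimes] at this
    push Not at this
    simpa using this
  obtain ⟨p, hp, hmp⟩ := (Ideal.subset_union_prime_finite (associatedPrimes.finite R R) ⊥ ⊥
    fun p hp _ _ => hp.1).1 hsub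
  obtain ⟨hp1, w, hw⟩ := isAssociatedPrime_iff.1 hp
  obtain ⟨r, hr, hrw⟩ := h' w (by
    rintro rfl
    exact hp1.ne_top (by rw [hw]; ext; simp [Submodule.mem_colon_singleton]))
  apply hrw
  have := hmp hr
  rwa [hw, Submodule.mem_colon_singleton] at this

end parameterIdeals

section gorenstein

lemma isParameterIdeal_bot_iff {R : Type u} [CommRing R] [IsLocalRing R] [IsNoetherianRing R]
    (hd : ringKrullDim R = (0 : ℕ)) {I : Ideal R} : IsParameterIdeal R I ↔ I = ⊥ := by
  refine ⟨?_, ?_⟩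
  · rintro ⟨d, a, hd', -, rfl, -⟩
    obtain rfl : d = 0 := by rw [hd] at hd'; exact_mod_cast hd'.symm
    simp
  · rintro rfl
    obtain ⟨a, ha, hrad⟩ := exists_radical_span_range_eq_maximalIdeal hd
    have : Ideal.span (Set.range a) = ⊥ := by simp
    exact ⟨0, a, hd, ha, this.symm, by rw [← this, hrad]⟩

variable {R : Type u} [CommRing R] [IsLocalRing R] [IsNoetherianRing R]

lemma exists_mul_ne_zero_of_parameter_ideals_irreducible {d : ℕ}
    (hd : ringKrullDim R = (d + 1 : ℕ))
    (h : ∀ I : Ideal R, IsParameterIdeal R I → IsIrreducibleIdeal I) {w : R} (hw : w ≠ 0) :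
    ∃ r ∈ maximalIdeal R, r * w ≠ 0 := by
  by_contra! hmw
  obtain ⟨a, ham, harad⟩ := exists_radical_span_range_eq_maximalIdeal hd
  obtain ⟨N, hN⟩ : ∃ N, w ∉ maximalIdeal R ^ N := by
    by_contra! hN
    have := Ideal.iInf_pow_eq_bot_of_isLocalRing (maximalIdeal R) Ideal.IsPrime.ne_top'
    exact hw (by rw [← Ideal.mem_bot, ← this]; simpa using hN)
  let b (i : Fin (d + 1)) : R := a i ^ (N + 1)
  have hbm (i) : b i ∈ maximalIdeal R := Ideal.pow_mem_of_mem _ (ham i) _ N.succ_pos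
  let T := Ideal.span (Set.range (Fin.tail b))
  have hrad (J : Ideal R) (hJm : J ≤ maximalIdeal R) (hTJ : T ≤ J) (hJ : b 0 ∈ J.radical) :
      J.radical = maximalIdeal R := by
    refine Ideal.radical_eq_maximalIdeal_of_forall hJm fun x hx => ?_
    rw [← harad] at hx
    refine Ideal.radical_le_radical_iff.2 (Ideal.span_le.2 ?_) hx
    rintro _ ⟨i, rfl⟩
    refine Fin.cases ?_ (fun i => ?_) i
    · rw [← Ideal.radical_idem]
      exact ⟨_, hJ⟩
    · exact ⟨_, hTJ (Ideal.subset_span ⟨i, rfl⟩)⟩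
  have hTm : T ≤ maximalIdeal R := by
    rw [Ideal.span_le]
    rintro _ ⟨i, rfl⟩
    exact hbm _
  let Q := T ⊔ Ideal.span {b 0}
  let Q' := T ⊔ Ideal.span {b 0 ^ 2}
  have hwQ : w ∉ Q := by
    have hbN (i) : b i ∈ maximalIdeal R ^ N :=
      Ideal.pow_le_pow_right N.le_succ (Ideal.pow_mem_pow (ham i) _)
    refine fun hw => hN ((sup_le (Ideal.span_le.2 ?_) ?_ : Q ≤ maximalIdeal R ^ N) hw)
    · rintro _ ⟨i, rfl⟩
      exact hbN _
    · exact (Ideal.span_singleton_le_iff_mem _).2 (hbN 0)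
  have hb0 : b 0 ∉ Q' := by
    intro hb
    obtain ⟨t, ht, y, hy, hty⟩ := Submodule.mem_sup.1 hb
    obtain ⟨r, rfl⟩ := Ideal.mem_span_singleton'.1 hy
    have hunit : IsUnit (1 - r * b 0) :=
      isUnit_one_sub_self_of_mem_nonunits _ ((maximalIdeal R).mul_mem_left r (hbm 0))
    have hb0T : b 0 ∈ T := by
      rw [← Ideal.mul_unit_mem_iff_mem _ hunit]
      convert ht using 1
      linear_combination -hty
    have := ringKrullDim_le_of_radical_span_range (hrad T hTm le_rfl (Ideal.le_radical hb0T))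
    rw [hd] at this
    have : d + 1 ≤ d := by exact_mod_cast this
    omega
  have hQ'Q : Q' ≤ Q :=
    sup_le_sup_left ((Ideal.span_singleton_le_span_singleton).2 (dvd_pow_self _ two_ne_zero)) _
  have hQm : Q ≤ maximalIdeal R :=
    sup_le hTm ((Ideal.span_singleton_le_iff_mem _).2 (hbm 0))
  have hQ' : IsParameterIdeal R Q' := by
    refine ⟨d + 1, Fin.cons (b 0 ^ 2) (Fin.tail b), hd, ?_, ?_, ?_⟩
    · rw [Fin.forall_fin_succ]
      exact ⟨Ideal.pow_mem_of_mem _ (hbm 0) _ two_pos, fun i => hbm _⟩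
    · rw [Fin.range_cons, Ideal.span_insert, sup_comm]
    · exact hrad Q' (hQ'Q.trans hQm) le_sup_left
        ⟨2, Ideal.mem_sup_right (Ideal.mem_span_singleton_self _)⟩
  have hinf : Q' = Q ⊓ (Q' ⊔ Ideal.span {w}) := by
    refine le_antisymm (le_inf hQ'Q le_sup_left) ?_
    rintro y ⟨hyQ, hy⟩
    obtain ⟨q, hq, z, hz, rfl⟩ := Submodule.mem_sup.1 hy
    obtain ⟨r, rfl⟩ := Ideal.mem_span_singleton'.1 hz
    by_cases hr : IsUnit r
    · exact absurd ((Ideal.unit_mul_mem_iff_mem _ hr).1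
        ((Ideal.add_mem_iff_right _ (hQ'Q hq)).1 hyQ)) hwQ
    · rwa [hmw r hr, add_zero]
  rcases (h Q' hQ').2 Q (Q' ⊔ Ideal.span {w}) hinf with heq | heq
  · exact hb0 (heq ▸ Ideal.mem_sup_right (Ideal.mem_span_singleton_self _))
  · exact hwQ (hQ'Q (heq ▸ Ideal.mem_sup_right (Ideal.mem_span_singleton_self _)))

lemma exists_hasInjectiveDimensionLT_of_parameter_ideals_irreducible (d : ℕ) :
    ∀ (R : Type u) [CommRing R] [IsLocalRing R] [IsNoetherianRing R],
      ringKrullDim R = d → (∀ I : Ideal R, IsParameterIdeal R I → IsIrreducibleIdeal I) →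
      ∃ n, HasInjectiveDimensionLT (ModuleCat.of R R) n := by
  induction d with
  | zero =>
    intro R _ _ _ hd h
    have : Ring.KrullDimLE 0 R := ringKrullDimZero_iff_ringKrullDim_eq_zero.2 hd
    have := ((isParameterIdeal_bot_iff hd).2 rfl |> h ⊥).injective
    exact ⟨1, injective_iff_hasInjectiveDimensionLT_one.1
      ((Module.injective_iff_injective_object R R).1 this)⟩
  | succ d ih =>
    intro R _ _ _ hd h
    rcases exists_isSMulRegular_or_exists_socle R with ⟨x, hxm, hx⟩ | ⟨w, hw0, hw⟩
    · have := Ideal.Quotient.isLocalRing_of_ne_top (I := Ideal.span {x})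
        (by rwa [Ne, Ideal.span_singleton_eq_top])
      refine ModuleCat.exists_hasInjectiveDimensionLT_of_quotient hxm hx
        (ih _ (ringKrullDim_quotient_span_singleton_eq hxm hx hd) fun I hI => ?_)
      exact (h _ (hI.comap_quotient_mk hxm hx)).of_comap Ideal.Quotient.mk_surjective
    · obtain ⟨r, hr, hrw⟩ := exists_mul_ne_zero_of_parameter_ideals_irreducible hd h hw0
      exact absurd (hw r hr) hrw

lemma exists_associatedPrime_quotient_span_singleton {x : R} (hxm : x ∈ maximalIdeal R)
    (hx : IsSMulRegular R x) {p : Ideal R} (hp : p ∈ associatedPrimes R R) :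
    ∃ q ∈ associatedPrimes (R ⧸ Ideal.span {x}) (R ⧸ Ideal.span {x}),
      p ≤ q.comap (Ideal.Quotient.mk _) := by
  obtain ⟨hp1, w, hw⟩ := isAssociatedPrime_iff.1 hp
  have hmem (y : R) : y ∈ p ↔ y * w = 0 := by
    rw [hw, Submodule.mem_colon_singleton, Submodule.mem_bot, smul_eq_mul]
  let N : Ideal R := Submodule.torsionBySet R R p
  have hN (y : R) : y ∈ N ↔ ∀ r ∈ p, r * y = 0 := by
    simp [N, Submodule.mem_torsionBySet_iff]
  obtain ⟨y, hyN, hy⟩ : ∃ y ∈ N, y ∉ Ideal.span {x} := by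
    by_contra! hNx
    have hle : N ≤ Ideal.span {x} • N := by
      intro y hy
      obtain ⟨z, rfl⟩ := Ideal.mem_span_singleton'.1 (hNx y hy)
      rw [mul_comm]
      refine Submodule.smul_mem_smul (Ideal.mem_span_singleton_self x) ?_
      rw [hN] at hy ⊢
      intro r hr
      apply hx
      change x * (r * z) = x * 0
      rw [mul_zero, ← hy r hr]
      ring
    have hbot := Submodule.eq_bot_of_le_smul_of_le_jacobson_bot _ N
      (IsNoetherian.noetherian N) hle (by
        rwa [jacobson_eq_maximalIdeal _ bot_ne_top, Ideal.span_singleton_le_iff_mem])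
    have hwN : w ∈ N := (hN w).2 fun r hr => (hmem r).1 hr
    rw [hbot, Ideal.mem_bot] at hwN
    exact hp1.ne_top ((Ideal.eq_top_iff_one _).2 ((hmem 1).2 (by rw [hwN, mul_zero])))
  obtain ⟨q, hq, hle⟩ := exists_le_isAssociatedPrime_of_isNoetherianRing
    (R ⧸ Ideal.span {x}) (Ideal.Quotient.mk (Ideal.span {x}) y)
    (by rwa [Ne, Ideal.Quotient.eq_zero_iff_mem])
  refine ⟨q, hq, fun r hr => hle ?_⟩
  rw [Submodule.mem_colon_singleton, Submodule.mem_bot, smul_eq_mul, ← map_mul,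
    (hN y).1 hyN r hr, map_zero]

lemma ringKrullDim_quotient_and_irreducible_of_hasInjectiveDimensionLT (d : ℕ) :
    ∀ (R : Type u) [CommRing R] [IsLocalRing R] [IsNoetherianRing R],
      ringKrullDim R = d → (∃ n, HasInjectiveDimensionLT (ModuleCat.of R R) n) →
      (∀ p ∈ associatedPrimes R R, d ≤ ringKrullDim (R ⧸ p)) ∧
      ∀ I : Ideal R, IsParameterIdeal R I → IsIrreducibleIdeal I := by
  induction d with
  | zero =>
    intro R _ _ _ hd ⟨n, hn⟩
    have : Ring.KrullDimLE 0 R := ringKrullDimZero_iff_ringKrullDim_eq_zero.2 hd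
    refine ⟨fun p hp => ?_, fun I hI => ?_⟩
    · have := Ideal.Quotient.nontrivial_iff.2 hp.1.ne_top
      exact ringKrullDim_nonneg_of_nontrivial
    · obtain rfl := (isParameterIdeal_bot_iff hd).1 hI
      obtain ⟨p, hp⟩ := associatedPrimes.nonempty R R
      obtain ⟨hp1, w, hw⟩ := isAssociatedPrime_iff.1 hp
      have hpm := Ring.KrullDimLE.eq_maximalIdeal_of_isPrime p
      have hmem (y : R) : y ∈ p ↔ y * w = 0 := by
        rw [hw, Submodule.mem_colon_singleton, Submodule.mem_bot, smul_eq_mul]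
      have := ModuleCat.injective_self_of_socle (w := w) ?_ ?_ n hn
      · have := (Module.injective_iff_injective_object R R).2 this
        exact Module.Injective.isIrreducibleIdeal_bot
      · rintro rfl
        exact hp1.ne_top ((Ideal.eq_top_iff_one _).2 ((hmem 1).2 (mul_zero _)))
      · rw [← hpm]
        exact fun r => (hmem r).1
  | succ d ih =>
    intro R _ _ _ hd h
    have hass : ∀ p ∈ associatedPrimes R R, ((d + 1 : ℕ) : WithBot ℕ∞) ≤ ringKrullDim (R ⧸ p) := by
      intro p hp
      rcases exists_isSMulRegular_or_exists_socle R with ⟨x, hxm, hx⟩ | ⟨w, hw0, hw⟩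
      · have := Ideal.Quotient.isLocalRing_of_ne_top (I := Ideal.span {x})
          (by rwa [Ne, Ideal.span_singleton_eq_top])
        obtain ⟨q, hq, hpq⟩ := exists_associatedPrime_quotient_span_singleton hxm hx hp
        have hdq := (ih _ (ringKrullDim_quotient_span_singleton_eq hxm hx hd)
          (ModuleCat.exists_hasInjectiveDimensionLT_quotient hx h)).1 q hq
        have := hp.1
        let f := Ideal.quotientMap q (Ideal.Quotient.mk (Ideal.span {x})) hpq
        have hf : Function.Surjective f :=
          Ideal.quotientMap_surjective Ideal.Quotient.mk_surjective
        refine le_trans ?_ (ringKrullDim_succ_le_of_surjective f hf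
          (r := Ideal.Quotient.mk p x) (mem_nonZeroDivisors_of_ne_zero ?_) ?_)
        · rw [Nat.cast_add, Nat.cast_one]
          gcongr
        · rw [Ne, Ideal.Quotient.eq_zero_iff_mem]
          exact isSMulRegular_iff_forall_notMem_associatedPrimes.1 hx p hp
        · rw [Ideal.quotientMap_mk, Ideal.Quotient.eq_zero_iff_mem.2
            (Ideal.mem_span_singleton_self x), map_zero]
      · obtain ⟨n, hn⟩ := h
        have := ModuleCat.injective_self_of_socle hw0 hw n hn
        have : Ring.KrullDimLE 0 R := by
          refine Ring.krullDimLE_zero_iff_forall_minimalPrimes_isMaximal.2 fun p hp => ?_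
          have hp' : p ∈ associatedPrimes R R :=
            Module.associatedPrimes.minimalPrimes_annihilator_subset_associatedPrimes R R
              (by rwa [Module.annihilator_eq_bot.2 inferInstance])
          rw [ModuleCat.eq_maximalIdeal_of_injective_self hp']
          exact maximalIdeal.isMaximal R
        rw [ringKrullDimZero_iff_ringKrullDim_eq_zero] at this
        rw [this] at hd
        have : 0 = d + 1 := by exact_mod_cast hd
        omega
    refine ⟨hass, ?_⟩
    rintro _ ⟨d', a, hd', ham, rfl, hrad⟩
    obtain rfl : d' = d + 1 := by rw [hd] at hd'; exact_mod_cast hd'.symm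
    have ha : IsSMulRegular R (a 0) := by
      refine isSMulRegular_iff_forall_notMem_associatedPrimes.2 fun p hp ha => ?_
      have := (hass p hp).trans
        (ringKrullDim_quotient_le_of_radical_span_range hrad hp.1.ne_top ha)
      have : d + 1 ≤ d := by exact_mod_cast this
      omega
    have := Ideal.Quotient.isLocalRing_of_ne_top (I := Ideal.span {a 0})
      (by rw [Ne, Ideal.span_singleton_eq_top]; exact ham 0)
    have hI := (ih _ (ringKrullDim_quotient_span_singleton_eq (ham 0) ha hd)
      (ModuleCat.exists_hasInjectiveDimensionLT_quotient ha h)).2 _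
      (isParameterIdeal_map_quotient_mk hd ham hrad ha)
    have := hI.comap Ideal.Quotient.mk_surjective
    rwa [Ideal.comap_map_of_surjective' _ Ideal.Quotient.mk_surjective, Ideal.mk_ker,
      sup_eq_left.2 ((Ideal.span_singleton_le_iff_mem _).2
        (Ideal.subset_span (Set.mem_range_self 0)))] at this

lemma hasFiniteInjectiveDimension_iff_exists_hasInjectiveDimensionLT {R : Type u} [CommRing R] :
    HasFiniteInjectiveDimension R ↔
      ∃ n, HasInjectiveDimensionLT (ModuleCat.of R R) n := by
  refine ⟨fun ⟨n, J, hJ⟩ => ⟨n + 1, ?_⟩, fun ⟨n, hn⟩ => ⟨n, ?_⟩⟩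
  · exact InjectiveResolution.hasInjectiveDimensionLT_of_isZero J _ hJ
  · have := hasInjectiveDimensionLT_of_ge (ModuleCat.of R R) n (n + 1) n.le_succ
    exact InjectiveResolution.exists_isZero_of_hasInjectiveDimensionLT n _ this

end gorenstein

end

theorem gorenstein_iff_parameter_ideals_irreducible (R : Type*) [CommRing R] [IsNoetherianRing R] [IsLocalRing R] :
    HasFiniteInjectiveDimension R ↔
      ∀ I : Ideal R, IsParameterIdeal R I → IsIrreducibleIdeal I := by
  obtain ⟨d, hd⟩ : ∃ d : ℕ, ringKrullDim R = d := by
    have h : ((maximalIdeal R).height : WithBot ℕ∞) = _ := maximalIdeal_height_eq_ringKrullDim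
    obtain ⟨d, hd⟩ := ENat.ne_top_iff_exists.1
      (Ideal.height_ne_top (I := maximalIdeal R) Ideal.IsPrime.ne_top')
    exact ⟨d, by rw [← h, ← hd]; rfl⟩
  rw [hasFiniteInjectiveDimension_iff_exists_hasInjectiveDimensionLT]
  exact ⟨fun h =>
    (ringKrullDim_quotient_and_irreducible_of_hasInjectiveDimensionLT d R hd h).2,
    exists_hasInjectiveDimensionLT_of_parameter_ideals_irreducible d R hd⟩
end

section
/- Let (R, m) be a commutative Noetherian local ring and let a and b be irreducible parameter ideals of R with b ⊆ a. Then Hom_R(R/a, R/b) ≅ R/a as R-modules. -/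
open IsLocalRing

section HomLength

variable {R : Type*} [CommRing R] {X : Type*} [AddCommGroup X] [Module R X]

theorem length_linearMap_le_add_of_exact {K M P : Type*} [AddCommGroup K] [Module R K]
    [AddCommGroup M] [Module R M] [AddCommGroup P] [Module R P] {f : K →ₗ[R] M} {g : M →ₗ[R] P}
    (hfg : Function.Exact f g) (hg : Function.Surjective g) :
    Module.length R (M →ₗ[R] X) ≤ Module.length R (P →ₗ[R] X) + Module.length R (K →ₗ[R] X) := by
  have h := LinearMap.exact_lcomp_of_exact_of_surjective X hfg hg
  rw [Module.length_eq_add_of_exact (g.lcomp R X) (f.lcomp R X).rangeRestrict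
    (LinearMap.lcomp_injective_of_surjective g hg) (LinearMap.surjective_rangeRestrict _)
    (fun x ↦ by rw [← h x]; simp [Subtype.ext_iff])]
  gcongr
  exact Module.length_le_of_injective _ (Submodule.subtype_injective _)

theorem length_linearMap_le_one_of_isSimpleModule
    (hX : ∀ P Q : Submodule R X, P ⊓ Q = ⊥ → P = ⊥ ∨ Q = ⊥)
    (K : Type*) [AddCommGroup K] [Module R K] [IsSimpleModule R K] :
    Module.length R (K →ₗ[R] X) ≤ 1 := by
  rcases subsingleton_or_nontrivial (K →ₗ[R] X) with _ | _
  · simp [Module.length_eq_zero]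
  refine (Module.length_eq_one_iff.mpr
    (isSimpleModule_iff_toSpanSingleton_surjective.mpr ⟨inferInstance, fun f hf g ↦ ?_⟩)).le
  by_cases hg : g = 0
  · exact ⟨0, by simp [hg]⟩
  have hne : LinearMap.range f ⊓ LinearMap.range g ≠ ⊥ := fun h ↦ by
    rcases hX _ _ h with h | h
    · exact hf (LinearMap.range_eq_bot.mp h)
    · exact hg (LinearMap.range_eq_bot.mp h)
  obtain ⟨x, ⟨⟨k, rfl⟩, l, hl⟩, hx⟩ := Submodule.exists_mem_ne_zero_of_ne_bot hne
  have hl0 : l ≠ 0 := by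
    rintro rfl
    exact hx (by simpa using hl.symm)
  obtain ⟨c, rfl⟩ := IsSimpleModule.toSpanSingleton_surjective R hl0 k
  refine ⟨c, LinearMap.ext fun y ↦ ?_⟩
  obtain ⟨s, rfl⟩ := IsSimpleModule.toSpanSingleton_surjective R hl0 y
  simp only [LinearMap.toSpanSingleton_apply, LinearMap.smul_apply, map_smul] at hl ⊢
  rw [hl, smul_comm]

theorem IsFiniteLength.length_linearMap_le
    (hX : ∀ P Q : Submodule R X, P ⊓ Q = ⊥ → P = ⊥ ∨ Q = ⊥)
    {M : Type*} [AddCommGroup M] [Module R M] (hM : IsFiniteLength R M) :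
    Module.length R (M →ₗ[R] X) ≤ Module.length R M := by
  induction hM with
  | of_subsingleton => simp [Module.length_eq_zero]
  | @of_simple_quotient M _ _ N _ _ ih =>
    calc Module.length R (M →ₗ[R] X)
        ≤ Module.length R ((M ⧸ N) →ₗ[R] X) + Module.length R (N →ₗ[R] X) :=
          length_linearMap_le_add_of_exact (LinearMap.exact_subtype_mkQ N) N.mkQ_surjective
      _ ≤ 1 + Module.length R N :=
          add_le_add (length_linearMap_le_one_of_isSimpleModule hX _) ih
      _ = Module.length R M := by
          rw [Module.length_eq_add_of_exact N.subtype N.mkQ N.subtype_injective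
            N.mkQ_surjective (LinearMap.exact_subtype_mkQ N),
            Module.length_eq_one_iff.mpr ‹IsSimpleModule R (M ⧸ N)›, add_comm]

theorem IsFiniteLength.length_le_length_linearMap_of_surjective
    (hX : ∀ P Q : Submodule R X, P ⊓ Q = ⊥ → P = ⊥ ∨ Q = ⊥)
    {M P : Type*} [AddCommGroup M] [Module R M] [AddCommGroup P] [Module R P]
    (hM : IsFiniteLength R M) (hle : Module.length R M ≤ Module.length R (M →ₗ[R] X))
    {g : M →ₗ[R] P} (hg : Function.Surjective g) :
    Module.length R P ≤ Module.length R (P →ₗ[R] X) := by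
  have hK : IsFiniteLength R (LinearMap.ker g) := hM.of_injective (Submodule.subtype_injective _)
  have hexact := LinearMap.exact_subtype_ker_map g
  have h := hle.trans (length_linearMap_le_add_of_exact (X := X) hexact hg)
  rw [Module.length_eq_add_of_exact _ g (Submodule.subtype_injective _) hg hexact, add_comm] at h
  exact (ENat.add_le_add_iff_right (Module.length_ne_top_iff.mpr hK)).mp
    (h.trans (by gcongr; exact hK.length_linearMap_le hX))

theorem exists_injective_of_length_le_length_linearMap
    (hX : ∀ P Q : Submodule R X, P ⊓ Q = ⊥ → P = ⊥ ∨ Q = ⊥)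
    {M : Type*} [AddCommGroup M] [Module R M] [Nontrivial M] (hM : IsFiniteLength R M)
    (hM' : ∀ P Q : Submodule R M, P ⊓ Q = ⊥ → P = ⊥ ∨ Q = ⊥)
    (hle : Module.length R M ≤ Module.length R (M →ₗ[R] X)) :
    ∃ f : M →ₗ[R] X, Function.Injective f := by
  have := (isFiniteLength_iff_isNoetherian_isArtinian.mp hM).2
  obtain ⟨N, hN, -⟩ := (eq_bot_or_exists_atom_le (⊤ : Submodule R M)).resolve_left top_ne_bot
  by_contra! hinj
  have hker (f : M →ₗ[R] X) : N ≤ LinearMap.ker f := by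
    by_contra hf
    rcases hM' _ _ ((hN.not_le_iff_disjoint.mp hf).eq_bot) with h | h
    · exact hN.1 h
    · exact hinj f (LinearMap.ker_eq_bot.mp h)
  have hsurj : Function.Surjective (N.mkQ.lcomp R X) := fun f ↦
    ⟨N.liftQ f (hker f), N.liftQ_mkQ f (hker f)⟩
  have hQ : IsFiniteLength R (M ⧸ N) := hM.of_surjective N.mkQ_surjective
  have hlen := (hle.trans (Module.length_le_of_surjective _ hsurj)).trans (hQ.length_linearMap_le hX)
  rw [Module.length_eq_add_of_exact N.subtype N.mkQ N.subtype_injective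
    N.mkQ_surjective (LinearMap.exact_subtype_mkQ N)] at hlen
  nth_rw 2 [← zero_add (Module.length R (M ⧸ N))] at hlen
  have h0 := (ENat.add_le_add_iff_right (Module.length_ne_top_iff.mpr hQ)).mp hlen
  have := Module.length_eq_zero_iff.mp (nonpos_iff_eq_zero.mp h0)
  exact hN.1 (Submodule.subsingleton_iff_eq_bot.mp this)

theorem IsFiniteLength.bijective_of_injective_of_length_le
    {M N : Type*} [AddCommGroup M] [Module R M] [AddCommGroup N] [Module R N]
    (hM : IsFiniteLength R M) {f : M →ₗ[R] N} (hf : Function.Injective f)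
    (hle : Module.length R N ≤ Module.length R M) : Function.Bijective f := by
  refine ⟨hf, ?_⟩
  rw [Module.length_eq_add_of_exact f (LinearMap.range f).mkQ hf (Submodule.mkQ_surjective _)
    (LinearMap.exact_map_mkQ_range f)] at hle
  nth_rw 2 [← add_zero (Module.length R M)] at hle
  have h0 := (ENat.add_le_add_iff_left (Module.length_ne_top_iff.mpr hM)).mp hle
  have := Module.length_eq_zero_iff.mp (nonpos_iff_eq_zero.mp h0)
  exact LinearMap.range_eq_top.mp (Submodule.Quotient.subsingleton_iff.mp this)

end HomLength

theorem IsIrreducibleIdeal.eq_bot_or_eq_bot_of_inf_eq_bot {R : Type*} [CommRing R] {I : Ideal R}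
    (hI : IsIrreducibleIdeal I) (P Q : Submodule R (R ⧸ I)) (h : P ⊓ Q = ⊥) :
    P = ⊥ ∨ Q = ⊥ := by
  have hbot : (⊥ : Submodule R (R ⧸ I)).comap (Submodule.mkQ I) = I := Submodule.ker_mkQ I
  have hinj := Submodule.comap_injective_of_surjective (Submodule.mkQ_surjective I)
  refine (hI.2 (P.comap (Submodule.mkQ I)) (Q.comap (Submodule.mkQ I)) ?_).imp
    (fun h ↦ hinj (h.symm.trans hbot.symm)) (fun h ↦ hinj (h.symm.trans hbot.symm))
  rw [← Submodule.comap_inf, h, hbot]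

theorem IsParameterIdeal.isFiniteLength_quotient {R : Type*} [CommRing R] [IsNoetherianRing R]
    [IsLocalRing R] {I : Ideal R} (hI : IsParameterIdeal R I) : IsFiniteLength R (R ⧸ I) := by
  obtain ⟨-, -, -, -, -, hrad⟩ := hI
  have : IsArtinianRing (R ⧸ I) :=
    IsLocalRing.quotient_artinian_of_mem_minimalPrimes_of_isLocalRing I (by
      rw [← Ideal.radical_minimalPrimes, hrad, Ideal.minimalPrimes_eq_subsingleton_self]
      exact Set.mem_singleton _)
  exact isFiniteLength_iff_isNoetherian_isArtinian.mpr ⟨inferInstance,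
    isArtinian_of_surjective_algebraMap (Ideal.Quotient.mk_surjective (I := I))⟩

theorem hom_quotient_iso_of_irreducible_parameter_ideals (R : Type*) [CommRing R] [IsNoetherianRing R] [IsLocalRing R]
    (a b : Ideal R) (ha : IsParameterIdeal R a) (hb : IsParameterIdeal R b)
    (ha' : IsIrreducibleIdeal a) (hb' : IsIrreducibleIdeal b) (hba : b ≤ a) :
    Nonempty (((R ⧸ a) →ₗ[R] (R ⧸ b)) ≃ₗ[R] (R ⧸ a)) := by
  have hX := hb'.eq_bot_or_eq_bot_of_inf_eq_bot
  have hA := ha.isFiniteLength_quotient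
  have : Nontrivial (R ⧸ a) := Ideal.Quotient.nontrivial_iff.mpr ha'.1
  have hself : Module.length R (R ⧸ b) ≤ Module.length R ((R ⧸ b) →ₗ[R] (R ⧸ b)) :=
    Module.length_le_of_injective (LinearMap.mul R (R ⧸ b)) fun x y h ↦ by
      simpa using LinearMap.congr_fun h 1
  have hle := hb.isFiniteLength_quotient.length_le_length_linearMap_of_surjective hX hself
    (Submodule.factor_surjective hba)
  obtain ⟨f, hf⟩ := exists_injective_of_length_le_length_linearMap hX hA
    ha'.eq_bot_or_eq_bot_of_inf_eq_bot hle
  let φ : (R ⧸ a) →ₗ[R] ((R ⧸ a) →ₗ[R] (R ⧸ b)) :=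
    (LinearMap.llcomp R (R ⧸ a) (R ⧸ a) (R ⧸ b) f) ∘ₗ LinearMap.mul R (R ⧸ a)
  have hφ : Function.Injective φ := fun x y h ↦
    hf (by simpa [φ] using LinearMap.congr_fun h 1)
  exact ⟨(LinearEquiv.ofBijective φ
    (hA.bijective_of_injective_of_length_le hφ (hA.length_linearMap_le hX))).symm⟩
end
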